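/- Let A, w, σ, ℓ, R > 0, set δ = ℓ²/R², let a < b be real numbers, and let y₁, y₂ ∈ ℝ. Define G⁻(y₁', y₂') = A exp(i y₁' y₂'/R²) N^w(y₁') N^σ(y₂') and the strip S = {(y₁', y₂') ∈ ℝ² : a ≤ y₁' − y₂' < b}. Then ∬_{S} G⁻(y₁', y₂') · exp( i (y₁ − y₁')(y₂ − y₂')/ℓ² ) dy₁' dy₂' = A · exp(i y₁ y₂/ℓ²) · ∫_{ℝ} exp(−i y₁' y₂/ℓ²) · N^w(y₁') · [ Φ^σ( (y₁ − (1+δ) y₁')/ℓ², y₁' − a ) − Φ^σ( (y₁ − (1+δ) y₁')/ℓ², y₁' − b ) ] dy₁'. -/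

import Mathlib

open MeasureTheory Complex

/-- The Gaussian `N^β(x) = exp(-x²/(2β²))`. -/
noncomputable def gaussN (β x : ℝ) : ℝ := Real.exp (-(x ^ 2) / (2 * β ^ 2))

/-- The truncated-Gaussian Fourier integral `Φ^σ(ω,u) = ∫_{-∞}^u exp(-iωx) N^σ(x) dx`. -/
noncomputable def Phi (σ ω u : ℝ) : ℂ :=
  ∫ x in Set.Iic u, Complex.exp (-Complex.I * ((ω * x : ℝ) : ℂ)) * ((gaussN σ x : ℝ) : ℂ)

theorem continuous_gaussN (β : ℝ) : Continuous (gaussN β) := by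
  unfold gaussN; fun_prop

theorem integrable_gaussN {β : ℝ} (hβ : 0 < β) : Integrable (gaussN β) := by
  convert integrable_exp_neg_mul_sq (b := (2 * β ^ 2)⁻¹) (by positivity) using 2 with x
  unfold gaussN
  congr 1
  ring

theorem norm_exp_neg_I_mul_ofReal (t : ℝ) : ‖exp (-I * (t : ℂ))‖ = 1 := by
  simpa [mul_comm] using norm_exp_ofReal_mul_I (-t)

theorem integrable_exp_mul_gaussN {σ : ℝ} (hσ : 0 < σ) (ω : ℝ) :
    Integrable fun x : ℝ => exp (-I * ((ω * x : ℝ) : ℂ)) * ((gaussN σ x : ℝ) : ℂ) := by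
  refine (integrable_gaussN hσ).ofReal.bdd_mul (c := 1) ?_ ?_
  · exact Continuous.aestronglyMeasurable (by fun_prop)
  · exact .of_forall fun x => (norm_exp_neg_I_mul_ofReal _).le

theorem Phi_sub_Phi {σ : ℝ} (hσ : 0 < σ) (ω : ℝ) {u v : ℝ} (huv : u ≤ v) :
    Phi σ ω v - Phi σ ω u =
      ∫ x in Set.Ioc u v, exp (-I * ((ω * x : ℝ) : ℂ)) * ((gaussN σ x : ℝ) : ℂ) := by
  have h := integrable_exp_mul_gaussN hσ ω
  rw [Phi, Phi, intervalIntegral.integral_Iic_sub_Iic h.integrableOn h.integrableOn,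
    intervalIntegral.integral_of_le huv]

theorem integrable_gaussSchell_mul_fresnel {w σ : ℝ} (hw : 0 < w) (hσ : 0 < σ)
    (A ℓ R y₁ y₂ : ℝ) :
    Integrable fun p : ℝ × ℝ =>
      ((A : ℝ) : ℂ) * exp (I * (((p.1 * p.2) / R ^ 2 : ℝ) : ℂ)) *
        ((gaussN w p.1 : ℝ) : ℂ) * ((gaussN σ p.2 : ℝ) : ℂ) *
        exp (I * ((((y₁ - p.1) * (y₂ - p.2)) / ℓ ^ 2 : ℝ) : ℂ)) := by
  have hcw := continuous_gaussN w
  have hcσ := continuous_gaussN σ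
  refine (((integrable_gaussN hw).mul_prod (integrable_gaussN hσ)).const_mul |A|).mono' ?_ ?_
  · exact Continuous.aestronglyMeasurable (by fun_prop)
  · refine .of_forall fun p => ?_
    have hN (β x : ℝ) : |gaussN β x| = gaussN β x := abs_of_pos (Real.exp_pos _)
    simp only [norm_mul, norm_exp_I_mul_ofReal, norm_real, Real.norm_eq_abs, hN]
    exact le_of_eq (by ring)

/-- Separation of the phase of the propagated field into a part linear in the coherence
coordinate `y` and a part independent of it. -/
theorem gaussSchell_phase_eq {ℓ R : ℝ} (hℓ : ℓ ≠ 0) (y₁ y₂ x y : ℝ) :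
    exp (I * ((x * y / R ^ 2 : ℝ) : ℂ)) *
        exp (I * (((y₁ - x) * (y₂ - y) / ℓ ^ 2 : ℝ) : ℂ)) =
      exp (I * ((y₁ * y₂ / ℓ ^ 2 : ℝ) : ℂ)) * exp (-I * ((x * y₂ / ℓ ^ 2 : ℝ) : ℂ)) *
        exp (-I * (((y₁ - (1 + ℓ ^ 2 / R ^ 2) * x) / ℓ ^ 2 * y : ℝ) : ℂ)) := by
  have h : x * y / R ^ 2 + (y₁ - x) * (y₂ - y) / ℓ ^ 2 = y₁ * y₂ / ℓ ^ 2 - x * y₂ / ℓ ^ 2 -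
      (y₁ - (1 + ℓ ^ 2 / R ^ 2) * x) / ℓ ^ 2 * y := by
    field_simp
    ring
  simp only [← exp_add, neg_mul, ← sub_eq_add_neg, ← mul_add, ← mul_sub, ← ofReal_add,
    ← ofReal_sub, h]

/-- The Fresnel integral of a Gauss-Schell field over a diagonal strip
`S = {a ≤ y₁' - y₂' < b}` reduces to a single integral of Gaussian-weighted differences
of truncated-Gaussian Fourier integrals, by integrating out the coherence coordinate. -/
theorem strip_integral_reduction
    (A w σ ℓ R : ℝ) (hA : 0 < A) (hw : 0 < w) (hσ : 0 < σ) (hℓ : 0 < ℓ) (hR : 0 < R)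
    (δ : ℝ) (hδ : δ = ℓ ^ 2 / R ^ 2)
    (a b : ℝ) (hab : a < b) (y₁ y₂ : ℝ) :
    (∫ p in {q : ℝ × ℝ | a ≤ q.1 - q.2 ∧ q.1 - q.2 < b},
        ((A : ℝ) : ℂ) * Complex.exp (Complex.I * (((p.1 * p.2) / R ^ 2 : ℝ) : ℂ)) *
          ((gaussN w p.1 : ℝ) : ℂ) * ((gaussN σ p.2 : ℝ) : ℂ) *
          Complex.exp (Complex.I * ((((y₁ - p.1) * (y₂ - p.2)) / ℓ ^ 2 : ℝ) : ℂ))) =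
      ((A : ℝ) : ℂ) * Complex.exp (Complex.I * (((y₁ * y₂) / ℓ ^ 2 : ℝ) : ℂ)) *
        ∫ x : ℝ, Complex.exp (-Complex.I * ((x * y₂ / ℓ ^ 2 : ℝ) : ℂ)) *
          ((gaussN w x : ℝ) : ℂ) *
          (Phi σ ((y₁ - (1 + δ) * x) / ℓ ^ 2) (x - a) -
           Phi σ ((y₁ - (1 + δ) * x) / ℓ ^ 2) (x - b)) := by
  subst hδ
  have hS : MeasurableSet {q : ℝ × ℝ | a ≤ q.1 - q.2 ∧ q.1 - q.2 < b} := by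
    rw [Set.ofPred_and]
    exact (measurableSet_le (by fun_prop) (by fun_prop)).inter
      (measurableSet_lt (by fun_prop) (by fun_prop))
  rw [← integral_indicator hS, Measure.volume_eq_prod, integral_prod _
    ((integrable_gaussSchell_mul_fresnel hw hσ A ℓ R y₁ y₂).indicator hS),
    ← integral_const_mul]
  congr 1 with x
  rw [Phi_sub_Phi hσ _ (by linarith : x - b ≤ x - a), ← integral_const_mul,
    ← integral_const_mul, ← integral_indicator measurableSet_Ioc]
  congr 1 with y
  have hmem : (x, y) ∈ {q : ℝ × ℝ | a ≤ q.1 - q.2 ∧ q.1 - q.2 < b} ↔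
      y ∈ Set.Ioc (x - b) (x - a) := by
    simp only [Set.mem_ofPred_eq, Set.mem_Ioc]
    constructor <;> rintro ⟨h₁, h₂⟩ <;> constructor <;> linarith
  by_cases hy : y ∈ Set.Ioc (x - b) (x - a)
  · rw [Set.indicator_of_mem (hmem.2 hy), Set.indicator_of_mem hy]
    linear_combination (A : ℂ) * (gaussN w x : ℂ) * (gaussN σ y : ℂ) *
      gaussSchell_phase_eq (R := R) hℓ.ne' y₁ y₂ x y
  · rw [Set.indicator_of_notMem (hmem.not.2 hy), Set.indicator_of_notMem hy]
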